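/- Let r ≥ 1 be an integer, let z_1,…,z_r ∈ ℂ be roots of unity, let a = (a_1,…,a_r) ∈ ℂ^r, let D be a polydisc around a in ℂ^r, and let (u_N(s_1,…,s_r))_{N≥1} be a sequence of holomorphic functions on D converging uniformly on D to a holomorphic function u(s_1,…,s_r). Suppose that for all non-negative integers k_1,…,k_r, the k = (k_1,…,k_r)-th Taylor coefficient of u_N at a is of the form P_k(N, log N) + o(1) as N → ∞, where P_k(N, log N) = Σ_{i,j ≥ 0} a_k^{(i,j)}(N)·N^i·(log N)^j is a finite sum with each coefficient sequence (a_k^{(i,j)}(N))_{N≥1} belonging to C_z. Then P_k(N, log N) = a_k^{(0,0)}(N) (i.e. a_k^{(i,j)}(N) = 0 for all N whenever (i,j) ≠ (0,0)), the sequence (a_k^{(0,0)}(N))_{N≥1} converges to a complex number a_k, and u has the power series expansion u(s_1,…,s_r) = Σ_{k_1,…,k_r ≥ 0} a_{(k_1,…,k_r)}(s_1−a_1)^{k_1}⋯(s_r−a_r)^{k_r} on D. -/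

import Mathlib

open scoped Classical
open Filter Topology

/-- The ℂ-algebra `C_z` of sequences generated by the constant sequence `1` and the
sequences `(z_i^n)_{n}` for `1 ≤ i ≤ r`. -/
noncomputable def Cz {r : ℕ} (z : Fin r → ℂ) : Subalgebra ℂ (ℕ → ℂ) :=
  Algebra.adjoin ℂ {f : ℕ → ℂ | ∃ i : Fin r, f = fun n => z i ^ n}

open Asymptotics in
lemma pl_aux {i j i' j' : ℕ} (h : i < i' ∨ (i = i' ∧ j < j')) :
    (fun x : ℝ => x ^ i * Real.log x ^ j) =o[atTop] (fun x : ℝ => x ^ i' * Real.log x ^ j') := by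
  rcases h with h | ⟨rfl, h⟩
  · have h1 : (fun x : ℝ => x ^ i * Real.log x ^ j) =o[atTop] (fun x : ℝ => x ^ i * x) :=
      (isBigO_refl _ _).mul_isLittleO Real.isLittleO_pow_log_id_atTop
    refine h1.trans_isBigO ?_
    refine IsBigO.of_bound 1 ?_
    filter_upwards [eventually_ge_atTop (1 : ℝ), Real.tendsto_log_atTop.eventually_ge_atTop 1]
      with x hx hl
    rw [one_mul, Real.norm_of_nonneg (by positivity), Real.norm_of_nonneg (by positivity),
      ← pow_succ]
    have h2 : x ^ (i + 1) ≤ x ^ i' := pow_le_pow_right₀ hx h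
    have h3 : 1 ≤ Real.log x ^ j' := one_le_pow₀ hl
    have h4 : 0 ≤ x ^ i' := by positivity
    nlinarith
  · refine (isBigO_refl _ _).mul_isLittleO ?_
    exact (isLittleO_pow_pow_atTop_of_lt (𝕜 := ℝ) h).comp_tendsto Real.tendsto_log_atTop

open Asymptotics in
lemma coeff_zero (S : Finset (ℕ × ℕ)) (α : ℕ × ℕ → ℂ) (x : ℕ → ℝ) (hx : Tendsto x atTop atTop)
    (L : ℂ)
    (h : Tendsto (fun t => ∑ p ∈ S, α p * (x t : ℂ) ^ p.1 * (Real.log (x t) : ℂ) ^ p.2)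
      atTop (𝓝 L)) : ∀ p ∈ S, p ≠ (0, 0) → α p = 0 := by
  intro p0 hp0 hne
  by_contra hα
  set T := S.filter (fun p => α p ≠ 0) with hT
  have hp0T : p0 ∈ T := by simp [hT, hp0, hα]
  obtain ⟨q, hqT, hq⟩ := Finset.exists_max_image T (fun p => toLex p) ⟨p0, hp0T⟩
  have hlt : ∀ p ∈ T, p ≠ q → p.1 < q.1 ∨ (p.1 = q.1 ∧ p.2 < q.2) := by
    intro p hp hpq
    have h1 : toLex p < toLex q := lt_of_le_of_ne (hq p hp) (fun e => hpq (toLex.injective e))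
    exact (Prod.Lex.toLex_lt_toLex).1 h1
  have hqne : q ≠ (0, 0) := by
    intro hq0
    have := hlt p0 hp0T (by rw [hq0]; exact hne)
    rw [hq0] at this
    simp at this
  have hsum : ∀ t, ∑ p ∈ S, α p * (x t : ℂ) ^ p.1 * (Real.log (x t) : ℂ) ^ p.2 =
      α q * (x t : ℂ) ^ q.1 * (Real.log (x t) : ℂ) ^ q.2 +
      ∑ p ∈ T.erase q, α p * (x t : ℂ) ^ p.1 * (Real.log (x t) : ℂ) ^ p.2 := by
    intro t
    rw [Finset.add_sum_erase T (fun p => α p * (x t : ℂ) ^ p.1 * (Real.log (x t) : ℂ) ^ p.2) hqT]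
    symm
    apply Finset.sum_subset (Finset.filter_subset _ _)
    intro p hp hpT
    have : α p = 0 := by
      by_contra hh
      exact hpT (by simp [hp, hh])
    simp [this]
  set g : ℕ → ℝ := fun t => x t ^ q.1 * Real.log (x t) ^ q.2 with hg
  have hrest : (fun t => ∑ p ∈ T.erase q, α p * (x t : ℂ) ^ p.1 * (Real.log (x t) : ℂ) ^ p.2)
      =o[atTop] g := by
    apply IsLittleO.fun_sum
    intro p hp
    have h1 := (pl_aux (hlt p (Finset.mem_of_mem_erase hp) (Finset.ne_of_mem_erase hp))).comp_tendsto hx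
    have h2 : (fun t => (((x t) ^ p.1 * Real.log (x t) ^ p.2 : ℝ) : ℂ)) =o[atTop] g := by
      refine IsLittleO.of_norm_left ?_
      simpa only [Complex.norm_real, Function.comp_def] using h1.norm_left
    refine (h2.const_mul_left (α p)).congr_left ?_
    intro t
    push_cast
    ring
  have hone : (fun _ : ℕ => (1 : ℝ)) =o[atTop] g := by
    have : (0 : ℕ) < q.1 ∨ ((0 : ℕ) = q.1 ∧ 0 < q.2) := by
      rcases q with ⟨q1, q2⟩
      simp only [ne_eq, Prod.mk.injEq] at hqne
      simp only
      omega
    simpa [Function.comp_def, hg] using (pl_aux this).comp_tendsto hx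
  have hL : (fun t => ∑ p ∈ S, α p * (x t : ℂ) ^ p.1 * (Real.log (x t) : ℂ) ^ p.2) =o[atTop] g :=
    (h.isBigO_one ℝ).trans_isLittleO hone
  have hq' : (fun t => α q * (x t : ℂ) ^ q.1 * (Real.log (x t) : ℂ) ^ q.2) =o[atTop] g := by
    refine (hL.sub hrest).congr_left ?_
    intro t
    rw [hsum t]; ring
  have hq2 : g =o[atTop] g := by
    have h3 := (hq'.const_mul_left (α q)⁻¹).norm_left
    have hαq : α q ≠ 0 := (Finset.mem_filter.1 hqT).2
    refine IsLittleO.of_norm_left (h3.congr_left ?_)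
    intro t
    rw [mul_assoc, inv_mul_cancel_left₀ hαq, hg]
    simp only [norm_mul, norm_pow, Complex.norm_real]
  have hnz : ∀ᶠ t in atTop, g t ≠ 0 := by
    filter_upwards [hx.eventually_gt_atTop 1] with t ht
    have := Real.log_pos ht
    have : 0 < x t := by linarith
    positivity
  exact isLittleO_irrefl hnz.frequently hq2

lemma Cz_periodic {r : ℕ} (z : Fin r → ℂ) (hz : ∀ i, ∃ m : ℕ, 0 < m ∧ z i ^ m = 1) :
    ∃ M : ℕ, 0 < M ∧ ∀ f ∈ Cz z, ∀ n, f (n + M) = f n := by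
  choose m hm hm1 using hz
  refine ⟨∏ i, m i, Finset.prod_pos (fun i _ => hm i), ?_⟩
  intro f hf
  refine Algebra.adjoin_induction (p := fun f _ => ∀ n, f (n + ∏ i, m i) = f n) ?_ ?_ ?_ ?_ hf
  · rintro _ ⟨i, rfl⟩ n
    obtain ⟨d, hd⟩ := Finset.dvd_prod_of_mem m (Finset.mem_univ i)
    simp only [hd, pow_add, pow_mul, hm1, one_pow, mul_one]
  · intro c n
    simp
  · intro f g _ _ hf hg n
    simp [hf, hg]
  · intro f g _ _ hf hg n
    simp [hf, hg]

lemma summable_geo {r : ℕ} (x : Fin r → ℝ) (h0 : ∀ i, 0 ≤ x i) (h1 : ∀ i, x i < 1) :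
    Summable (fun k : Fin r → ℕ => ∏ i, x i ^ k i) := by
  refine summable_of_sum_le (c := ∏ i, (1 - x i)⁻¹)
    (fun k => Finset.prod_nonneg (fun i _ => pow_nonneg (h0 i) _)) ?_
  intro U
  let n := U.sup (fun k => ∑ i, k i) + 1
  have hsub : U ⊆ Fintype.piFinset (fun _ : Fin r => Finset.range n) := by
    intro k hk
    rw [Fintype.mem_piFinset]
    intro i
    have h2 : k i ≤ ∑ i, k i := Finset.single_le_sum (fun _ _ => Nat.zero_le _) (Finset.mem_univ i)
    have h3 : ∑ i, k i ≤ U.sup (fun k => ∑ i, k i) := Finset.le_sup (f := fun k => ∑ i, k i) hk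
    rw [Finset.mem_range]
    omega
  calc _ ≤ ∑ k ∈ Fintype.piFinset (fun _ : Fin r => Finset.range n), ∏ i, x i ^ k i :=
        Finset.sum_le_sum_of_subset_of_nonneg hsub
          (fun k _ _ => Finset.prod_nonneg (fun i _ => pow_nonneg (h0 i) _))
    _ = ∏ i, ∑ j ∈ Finset.range n, x i ^ j := (Finset.prod_univ_sum _ _).symm
    _ ≤ _ := by
        refine Finset.prod_le_prod (fun i _ => Finset.sum_nonneg (fun j _ => pow_nonneg (h0 i) _)) ?_
        intro i _
        rw [← tsum_geometric_of_lt_one (h0 i) (h1 i)]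
        exact (summable_geometric_of_lt_one (h0 i) (h1 i)).sum_le_tsum _
          (fun j _ => pow_nonneg (h0 i) _)

/-- Normalised Haar measure on the unit circle. -/
noncomputable local instance circleMS : MeasureTheory.MeasureSpace UnitAddCircle :=
  ⟨AddCircle.haarAddCircle⟩

local instance circleProb :
    MeasureTheory.IsProbabilityMeasure (MeasureTheory.volume : MeasureTheory.Measure UnitAddCircle) :=
  inferInstanceAs (MeasureTheory.IsProbabilityMeasure AddCircle.haarAddCircle)

open UnitAddTorus in
lemma fourier_bound (r : ℕ) : ∃ C : ℝ, 0 ≤ C ∧ ∀ b : (Fin r → ℕ) → ℂ, Summable (fun k => ‖b k‖) →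
    ∀ ε : ℝ, 0 ≤ ε → (∀ w : Fin r → ℂ, (∀ i, ‖w i‖ = 1) →
      ‖∑' k, b k * ∏ i, w i ^ k i‖ ≤ ε) → ∀ k, ‖b k‖ ≤ C * ε := by
  have horth := orthonormal_mFourier (d := Fin r)
  have key : ∃ T : C(UnitAddTorus (Fin r), ℂ) →L[ℂ] _, ∀ n, T (mFourier n) = mFourierLp (d := Fin r) 2 n :=
    ⟨ContinuousMap.toLp (E := ℂ) 2 _ ℂ, fun n => rfl⟩
  obtain ⟨T, hT⟩ := key
  refine ⟨‖T‖, T.opNorm_nonneg, ?_⟩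
  intro b hb ε hε hw k
  let e : (Fin r → ℕ) → (Fin r → ℤ) := fun k i => (k i : ℤ)
  have he : Function.Injective e := by
    intro k l h
    funext i
    have := congrFun h i
    simpa [e] using this
  let F : (Fin r → ℕ) → C(UnitAddTorus (Fin r), ℂ) := fun k => b k • mFourier (e k)
  have hF : Summable F := by
    refine Summable.of_norm (hb.congr ?_)
    intro k
    simp only [F]
    rw [norm_smul, mFourier_norm, mul_one]
  have hG : ‖∑' k, F k‖ ≤ ε := by
    rw [ContinuousMap.norm_le _ hε]
    intro x
    rw [← ContinuousMap.tsum_apply hF]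
    have := hw (fun i => fourier 1 (x i)) (fun i => by rw [fourier_apply, Circle.norm_coe])
    convert! this using 4 with k
    simp only [F, e, ContinuousMap.smul_apply, smul_eq_mul, mFourier, ContinuousMap.coe_mk]
    congr 1
    refine Finset.prod_congr rfl fun i _ => ?_
    rw [fourier_apply, fourier_apply, one_zsmul, natCast_zsmul, AddCircle.toCircle_nsmul]
    simp
  have h1 := (hF.hasSum.mapL T).mapL (innerSL ℂ (mFourierLp (d := Fin r) 2 (e k)))
  have h2 : HasSum (fun l => innerSL ℂ (mFourierLp (d := Fin r) 2 (e k)) (T (F l))) (b k) := by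
    convert hasSum_ite_eq k (b k) using 2 with l
    simp only [F, map_smul, hT, innerSL_apply_apply, orthonormal_iff_ite.1 horth, he.eq_iff]
    by_cases hkl : l = k
    · simp [hkl]
    · simp [hkl, Ne.symm hkl]
  rw [h2.unique h1, innerSL_apply_apply]
  refine (norm_inner_le_norm _ _).trans ?_
  rw [horth.1, one_mul]
  exact (T.le_opNorm _).trans (by gcongr)

lemma cauchy_bound (r : ℕ) : ∃ C : ℝ, 0 ≤ C ∧ ∀ (a : Fin r → ℂ) (ρ R : Fin r → ℝ),
    (∀ i, 0 < R i) → (∀ i, R i < ρ i) → ∀ (f : (Fin r → ℂ) → ℂ) (c : (Fin r → ℕ) → ℂ),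
    (∀ s : Fin r → ℂ, (∀ i, ‖s i - a i‖ < ρ i) →
      HasSum (fun k : Fin r → ℕ => c k * ∏ i, (s i - a i) ^ k i) (f s)) →
    ∀ ε : ℝ, 0 ≤ ε → (∀ s : Fin r → ℂ, (∀ i, ‖s i - a i‖ < ρ i) → ‖f s‖ ≤ ε) →
    ∀ k, ‖c k‖ * ∏ i, R i ^ k i ≤ C * ε := by
  obtain ⟨C, hC, H⟩ := fourier_bound r
  refine ⟨C, hC, ?_⟩
  intro a ρ R hR hRρ f c hf ε hε hb k
  have hin : ∀ w : Fin r → ℂ, (∀ i, ‖w i‖ = 1) →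
      ∀ i, ‖(fun i => a i + R i * w i) i - a i‖ < ρ i := by
    intro w hw i
    simp only [add_sub_cancel_left, norm_mul, hw, mul_one, Complex.norm_real,
      Real.norm_of_nonneg (hR i).le, hRρ i]
  have hs : ∀ w : Fin r → ℂ, (∀ i, ‖w i‖ = 1) →
      HasSum (fun k : Fin r → ℕ => (c k * ∏ i, (R i : ℂ) ^ k i) * ∏ i, w i ^ k i)
        (f (fun i => a i + R i * w i)) := by
    intro w hw
    convert hf _ (hin w hw) using 2 with k
    simp only [add_sub_cancel_left, mul_pow, Finset.prod_mul_distrib, mul_assoc]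
  have hsum : Summable (fun k : Fin r → ℕ => ‖c k * ∏ i, (R i : ℂ) ^ k i‖) := by
    have := (hs (fun _ => 1) (by simp)).summable.norm
    simpa only [one_pow, Finset.prod_const_one, mul_one] using this
  have := H _ hsum ε hε (fun w hw => by
    rw [(hs w hw).tsum_eq]
    exact hb _ (hin w hw)) k
  convert this using 1
  rw [norm_mul, norm_prod]
  congr 1
  refine Finset.prod_congr rfl fun i _ => ?_
  rw [norm_pow, Complex.norm_real, Real.norm_of_nonneg (hR i).le]

lemma limit_part (r : ℕ)
    (a : Fin r → ℂ) (ρ : Fin r → ℝ) (hρ : ∀ i, 0 < ρ i)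
    (u : ℕ → (Fin r → ℂ) → ℂ) (uLim : (Fin r → ℂ) → ℂ)
    (hconv : TendstoUniformlyOn u uLim atTop {s : Fin r → ℂ | ∀ i, ‖s i - a i‖ < ρ i})
    (c : ℕ → (Fin r → ℕ) → ℂ)
    (hc : ∀ N, 1 ≤ N → ∀ s : Fin r → ℂ, (∀ i, ‖s i - a i‖ < ρ i) →
      HasSum (fun k : Fin r → ℕ => c N k * ∏ i, (s i - a i) ^ k i) (u N s)) :
    ∃ aa : (Fin r → ℕ) → ℂ,
      (∀ k : Fin r → ℕ, Tendsto (fun N => c N k) atTop (𝓝 (aa k))) ∧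
      ∀ s : Fin r → ℂ, (∀ i, ‖s i - a i‖ < ρ i) →
        HasSum (fun k : Fin r → ℕ => aa k * ∏ i, (s i - a i) ^ k i) (uLim s) := by
  obtain ⟨C, hC, H⟩ := cauchy_bound r
  -- uniform Cauchy estimate
  have hUC : ∀ ε : ℝ, 0 < ε → ∃ N0 : ℕ, ∀ N ≥ N0, ∀ M ≥ N0, ∀ R : Fin r → ℝ,
      (∀ i, 0 < R i) → (∀ i, R i < ρ i) → ∀ k, ‖c N k - c M k‖ * ∏ i, R i ^ k i ≤ C * ε := by
    intro ε hε
    obtain ⟨N0, hN0⟩ := eventually_atTop.1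
      ((Metric.tendstoUniformlyOn_iff.1 hconv) (ε / 2) (by positivity))
    refine ⟨max N0 1, ?_⟩
    intro N hN M hM R hR hRρ k
    have hN1 := (le_max_left _ _).trans hN
    have hN2 := (le_max_right _ _).trans hN
    have hM1 := (le_max_left _ _).trans hM
    have hM2 := (le_max_right _ _).trans hM
    refine H a ρ R hR hRρ (fun s => u N s - u M s) (fun k => c N k - c M k) ?_ ε hε.le ?_ k
    · intro s hs
      simpa only [sub_mul] using (hc N hN2 s hs).sub (hc M hM2 s hs)
    · intro s hs
      have h1 := hN0 N hN1 s hs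
      have h2 := hN0 M hM1 s hs
      rw [← dist_eq_norm]
      have := dist_triangle_left (u N s) (u M s) (uLim s)
      linarith
  have hlim : ∀ k, ∃ l, Tendsto (fun N => c N k) atTop (𝓝 l) := by
    intro k
    apply cauchySeq_tendsto_of_complete
    rw [Metric.cauchySeq_iff]
    intro ε hε
    set P := ∏ i, (ρ i / 2) ^ k i with hPdef
    have hP : 0 < P := Finset.prod_pos fun i _ => pow_pos (half_pos (hρ i)) _
    obtain ⟨N0, h0⟩ := hUC (P * ε / (2 * (C + 1))) (by positivity)
    refine ⟨N0, fun N hN M hM => ?_⟩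
    have h1 := h0 N hN M hM (fun i => ρ i / 2) (fun i => half_pos (hρ i))
      (fun i => half_lt_self (hρ i)) k
    rw [dist_eq_norm]
    have h2 : C * (P * ε / (2 * (C + 1))) < ε * P := by
      rw [mul_div_assoc', div_lt_iff₀ (by positivity)]
      have : 0 < P * ε := by positivity
      nlinarith
    exact lt_of_mul_lt_mul_right (h1.trans_lt h2) hP.le
  choose aa haa using hlim
  refine ⟨aa, haa, ?_⟩
  intro s hs
  have hR : ∀ i, ∃ R, ‖s i - a i‖ < R ∧ R < ρ i := fun i => exists_between (hs i)
  choose R hR1 hR2 using hR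
  have hR0 : ∀ i, 0 < R i := fun i => (norm_nonneg _).trans_lt (hR1 i)
  let x : Fin r → ℝ := fun i => ‖s i - a i‖ / R i
  have hgeo := summable_geo x (fun i => div_nonneg (norm_nonneg _) (hR0 i).le)
    (fun i => (div_lt_one (hR0 i)).2 (hR1 i))
  set G := ∑' k : Fin r → ℕ, ∏ i, x i ^ k i with hG
  have hG0 : 0 ≤ G := tsum_nonneg fun k => Finset.prod_nonneg fun i _ =>
    pow_nonneg (div_nonneg (norm_nonneg _) (hR0 i).le) _
  have hbd : ∀ ε : ℝ, 0 < ε → ∃ N0 : ℕ, ∀ N ≥ N0, ∀ k,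
      ‖(c N k - aa k) * ∏ i, (s i - a i) ^ k i‖ ≤ C * ε * ∏ i, x i ^ k i := by
    intro ε hε
    obtain ⟨N0, h0⟩ := hUC ε hε
    refine ⟨N0, fun N hN k => ?_⟩
    have h1 : ‖c N k - aa k‖ * ∏ i, R i ^ k i ≤ C * ε := by
      have ht : Tendsto (fun M => ‖c N k - c M k‖ * ∏ i, R i ^ k i) atTop
          (𝓝 (‖c N k - aa k‖ * ∏ i, R i ^ k i)) :=
        ((tendsto_const_nhds.sub (haa k)).norm).mul_const _
      refine le_of_tendsto ht ?_
      filter_upwards [eventually_ge_atTop N0] with M hM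
      exact h0 N hN M hM R hR0 hR2 k
    have h2 : ∏ i, ‖s i - a i‖ ^ k i = (∏ i, R i ^ k i) * ∏ i, x i ^ k i := by
      rw [← Finset.prod_mul_distrib]
      refine Finset.prod_congr rfl fun i _ => ?_
      rw [← mul_pow]
      congr 1
      have := (hR0 i).ne'
      simp only [x]
      field_simp
    rw [norm_mul, norm_prod]
    simp only [norm_pow]
    rw [h2, ← mul_assoc]
    exact mul_le_mul_of_nonneg_right h1 (Finset.prod_nonneg fun i _ =>
      pow_nonneg (div_nonneg (norm_nonneg _) (hR0 i).le) _)
  have hsm : Summable (fun k : Fin r → ℕ => aa k * ∏ i, (s i - a i) ^ k i) := by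
    obtain ⟨N0, h0⟩ := hbd 1 one_pos
    have h1 : Summable (fun k : Fin r → ℕ =>
        (c (max N0 1) k - aa k) * ∏ i, (s i - a i) ^ k i) :=
      Summable.of_norm_bounded (hgeo.mul_left (C * 1)) (h0 _ (le_max_left _ _))
    refine ((hc (max N0 1) (le_max_right _ _) s hs).summable.sub h1).congr ?_
    intro k
    ring
  have hto : Tendsto (fun N => u N s) atTop (𝓝 (∑' k : Fin r → ℕ, aa k * ∏ i, (s i - a i) ^ k i)) := by
    rw [Metric.tendsto_atTop]
    intro ε hε
    obtain ⟨N0, h0⟩ := hbd (ε / (2 * (C * G + 1))) (by positivity)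
    refine ⟨max N0 1, fun N hN => ?_⟩
    have h1 := ((hc N ((le_max_right _ _).trans hN) s hs).sub hsm.hasSum)
    simp only [← sub_mul] at h1
    have h2 := tsum_of_norm_bounded (hgeo.hasSum.mul_left (C * (ε / (2 * (C * G + 1)))))
      (h0 N ((le_max_left _ _).trans hN))
    rw [h1.tsum_eq] at h2
    rw [dist_eq_norm]
    refine h2.trans_lt ?_
    rw [← hG]
    have h3 : 0 ≤ C * G := by positivity
    have h4 : C * (ε / (2 * (C * G + 1))) * G = (C * G) * ε / (2 * (C * G + 1)) := by ring
    rw [h4, div_lt_iff₀ (by positivity)]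
    nlinarith
  have := tendsto_nhds_unique hto (hconv.tendsto_at hs)
  rw [← this]
  exact hsm.hasSum

/-- Taylor-coefficient regularisation lemma. If holomorphic functions `u N` on a
polydisc `D` around `a` converge uniformly to a holomorphic `u`, with Taylor coefficients
`c N k` of the form `P_k(N, log N) + o(1)` where `P_k(N, log N) = Σ_{i,j} A k i j N · Nⁱ (log N)ʲ`
is a finite sum with coefficient sequences in `C_z`, then only the `(0,0)` coefficient sequence
is non-zero, it converges to some `aa k`, and `u` has Taylor expansion with coefficients `aa k`
around `a` on `D`. -/
theorem taylor_coefficient_regularisation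
    (r : ℕ) (hr : 1 ≤ r) (z : Fin r → ℂ) (hz : ∀ i, ∃ m : ℕ, 0 < m ∧ z i ^ m = 1)
    (a : Fin r → ℂ) (ρ : Fin r → ℝ) (hρ : ∀ i, 0 < ρ i)
    (u : ℕ → (Fin r → ℂ) → ℂ) (uLim : (Fin r → ℂ) → ℂ)
    (hu : ∀ N, 1 ≤ N →
      DifferentiableOn ℂ (u N) {s : Fin r → ℂ | ∀ i, ‖s i - a i‖ < ρ i})
    (huLim : DifferentiableOn ℂ uLim {s : Fin r → ℂ | ∀ i, ‖s i - a i‖ < ρ i})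
    (hconv : TendstoUniformlyOn u uLim atTop {s : Fin r → ℂ | ∀ i, ‖s i - a i‖ < ρ i})
    -- `c N k` is the `k`-th Taylor coefficient of `u N` at `a`
    (c : ℕ → (Fin r → ℕ) → ℂ)
    (hc : ∀ N, 1 ≤ N → ∀ s : Fin r → ℂ, (∀ i, ‖s i - a i‖ < ρ i) →
      HasSum (fun k : Fin r → ℕ => c N k * ∏ i, (s i - a i) ^ k i) (u N s))
    -- the coefficient sequences `a_k^{(i,j)}` of the polynomial `P_k`
    (A : (Fin r → ℕ) → ℕ → ℕ → ℕ → ℂ)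
    (hAfin : ∀ k : Fin r → ℕ, {p : ℕ × ℕ | ∃ N, A k p.1 p.2 N ≠ 0}.Finite)
    (hACz : ∀ k : Fin r → ℕ, ∀ i j : ℕ, (fun N => A k i j N) ∈ Cz z)
    -- `c N k = P_k(N, log N) + o(1)` as `N → ∞`
    (hP : ∀ k : Fin r → ℕ,
      Tendsto
        (fun N : ℕ =>
          c N k - ∑ᶠ i : ℕ, ∑ᶠ j : ℕ, A k i j N * (N : ℂ) ^ i * (Real.log N : ℂ) ^ j)
        atTop (𝓝 0)) :
    (∀ k : Fin r → ℕ, ∀ i j : ℕ, (i, j) ≠ (0, 0) → ∀ N, A k i j N = 0) ∧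
    ∃ aa : (Fin r → ℕ) → ℂ,
      (∀ k : Fin r → ℕ, Tendsto (fun N => A k 0 0 N) atTop (𝓝 (aa k))) ∧
      ∀ s : Fin r → ℂ, (∀ i, ‖s i - a i‖ < ρ i) →
        HasSum (fun k : Fin r → ℕ => aa k * ∏ i, (s i - a i) ^ k i) (uLim s) := by
  obtain ⟨aa, haa, hexp⟩ := limit_part r a ρ hρ u uLim hconv c hc
  obtain ⟨M, hM, hper⟩ := Cz_periodic z hz
  have hsum : ∀ k N, ∑ᶠ i : ℕ, ∑ᶠ j : ℕ, A k i j N * (N : ℂ) ^ i * (Real.log N : ℂ) ^ j =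
      ∑ p ∈ (hAfin k).toFinset, A k p.1 p.2 N * (N : ℂ) ^ p.1 * (Real.log N : ℂ) ^ p.2 := by
    intro k N
    have hsupp : (Function.support (fun p : ℕ × ℕ =>
        A k p.1 p.2 N * (N : ℂ) ^ p.1 * (Real.log N : ℂ) ^ p.2)) ⊆ ((hAfin k).toFinset : Set (ℕ × ℕ)) := by
      intro p hp
      simp only [Set.Finite.coe_toFinset, Set.mem_ofPred_eq]
      refine ⟨N, fun h => hp ?_⟩
      simp [h]
    rw [← finsum_eq_sum_of_support_subset _ hsupp,
      finsum_curry _ ((Finset.finite_toSet _).subset hsupp)]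
  have hPl : ∀ k, Tendsto (fun N : ℕ => ∑ p ∈ (hAfin k).toFinset,
      A k p.1 p.2 N * (N : ℂ) ^ p.1 * (Real.log N : ℂ) ^ p.2) atTop (𝓝 (aa k)) := by
    intro k
    have := (haa k).sub (hP k)
    simpa only [hsum, sub_sub_cancel, sub_zero] using this
  have hzero : ∀ k : Fin r → ℕ, ∀ i j : ℕ, (i, j) ≠ (0, 0) → ∀ N, A k i j N = 0 := by
    intro k i j hij N
    by_contra hne
    have hmem : (i, j) ∈ (hAfin k).toFinset := by
      simp only [Set.Finite.mem_toFinset, Set.mem_ofPred_eq]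
      exact ⟨N, hne⟩
    have hper' : ∀ i j t, A k i j (N + t * M) = A k i j N := by
      intro i j t
      induction t with
      | zero => simp
      | succ t ih =>
        rw [Nat.succ_mul, ← add_assoc, ← ih]
        exact hper _ (hACz k i j) (N + t * M)
    have htop : Tendsto (fun t : ℕ => N + t * M) atTop atTop :=
      tendsto_atTop_mono (fun t => (Nat.le_mul_of_pos_right t hM).trans (Nat.le_add_left _ _))
        tendsto_id
    refine hne (coeff_zero (hAfin k).toFinset (fun p => A k p.1 p.2 N)
      (fun t => ((N + t * M : ℕ) : ℝ)) (tendsto_natCast_atTop_atTop.comp htop) (aa k) ?_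
      (i, j) hmem hij)
    refine ((hPl k).comp htop).congr ?_
    intro t
    simp only [Function.comp_def, hper', Complex.ofReal_natCast]
  refine ⟨hzero, aa, fun k => ?_, hexp⟩
  refine (hPl k).congr ?_
  intro N
  rw [Finset.sum_eq_single (0, 0)]
  · simp
  · intro p _ hp
    rw [hzero k p.1 p.2 hp N]
    simp
  · intro h
    have : A k 0 0 N = 0 := by
      by_contra hne
      exact h (by simp only [Set.Finite.mem_toFinset, Set.mem_ofPred_eq]; exact ⟨N, hne⟩)
    simp [this]
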